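/- If F = (P,Q) is a polynomial automorphism of ℂ² with deg P + deg Q > 2, then the Jacobian determinant of the leading homogeneous forms of P and Q vanishes identically: (P⁺)_x (Q⁺)_y − (P⁺)_y (Q⁺)_x ≡ 0, where P⁺ and Q⁺ denote the homogeneous components of P and Q of degrees deg P and deg Q, respectively. -/

import Mathlib

open MvPolynomial

/-- `(P, Q)` is a polynomial automorphism of ℂ²: the polynomial map
`F(x,y) = (P(x,y), Q(x,y))` admits a polynomial inverse `(P', Q')`. -/
def IsPolyAut (P Q : MvPolynomial (Fin 2) ℂ) : Prop :=
  ∃ P' Q' : MvPolynomial (Fin 2) ℂ,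
    (∀ v : Fin 2 → ℂ,
      eval ![eval v P, eval v Q] P' = v 0 ∧ eval ![eval v P, eval v Q] Q' = v 1) ∧
    (∀ v : Fin 2 → ℂ,
      eval ![eval v P', eval v Q'] P = v 0 ∧ eval ![eval v P', eval v Q'] Q = v 1)

namespace MvPolynomial

variable {σ R : Type*} [CommSemiring R]

theorem coeff_eq_zero_of_totalDegree_lt_degree {p : MvPolynomial σ R} {d : σ →₀ ℕ}
    (h : p.totalDegree < d.degree) : coeff d p = 0 := by
  by_contra hd
  exact absurd (le_totalDegree (mem_support_iff.mpr hd)) (not_le.mpr h)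

theorem homogeneousComponent_add_mul_of_totalDegree_le {p q : MvPolynomial σ R} {m n : ℕ}
    (hp : p.totalDegree ≤ m) (hq : q.totalDegree ≤ n) :
    homogeneousComponent (m + n) (p * q) =
      homogeneousComponent m p * homogeneousComponent n q := by
  classical
  ext d
  by_cases hd : d.degree = m + n
  · rw [coeff_homogeneousComponent, if_pos hd, coeff_mul, coeff_mul]
    refine Finset.sum_congr rfl fun x hx => ?_
    have hx' : x.1.degree + x.2.degree = m + n := by
      rw [← hd, ← Finset.HasAntidiagonal.mem_antidiagonal.mp hx, map_add]
    rw [coeff_homogeneousComponent, coeff_homogeneousComponent]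
    rcases lt_trichotomy x.1.degree m with h | h | h
    · rw [if_neg h.ne, coeff_eq_zero_of_totalDegree_lt_degree (p := q) (by lia)]
      simp
    · rw [if_pos h, if_pos (by lia)]
    · rw [if_neg h.ne', coeff_eq_zero_of_totalDegree_lt_degree (p := p) (by lia)]
      simp
  · rw [coeff_homogeneousComponent, if_neg hd]
    symm
    exact ((homogeneousComponent_isHomogeneous m p).mul
      (homogeneousComponent_isHomogeneous n q)).coeff_eq_zero hd

theorem homogeneousComponent_pderiv (i : σ) (n : ℕ) (p : MvPolynomial σ R) :
    homogeneousComponent n (pderiv i p) = pderiv i (homogeneousComponent (n + 1) p) := by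
  classical
  ext d
  simp only [coeff_homogeneousComponent, coeff_pderiv, map_add, Finsupp.degree_single,
    Nat.add_right_cancel_iff, ite_mul, zero_mul]

theorem totalDegree_pderiv_le {i : σ} {n : ℕ} {p : MvPolynomial σ R}
    (hp : p.totalDegree ≤ n + 1) : (pderiv i p).totalDegree ≤ n := by
  classical
  refine Finset.sup_le fun d hd => ?_
  by_contra h
  refine mem_support_iff.mp hd ?_
  rw [coeff_pderiv, coeff_eq_zero_of_totalDegree_lt_degree, zero_mul]
  rw [map_add, Finsupp.degree_single]
  change ¬ d.degree ≤ n at h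
  lia

theorem pderiv_bind₁ {τ : Type*} [Fintype σ] (f : σ → MvPolynomial τ R) (i : τ)
    (p : MvPolynomial σ R) :
    pderiv i (bind₁ f p) = ∑ j, bind₁ f (pderiv j p) * pderiv i (f j) := by
  classical
  induction p using MvPolynomial.induction_on with
  | C a => simp
  | add p q hp hq => simp [hp, hq, add_mul, Finset.sum_add_distrib]
  | mul_X p k hp =>
    simp only [map_mul, bind₁_X_right, pderiv_mul, hp, map_add, add_mul,
      Finset.sum_add_distrib, Finset.sum_mul, pderiv_X]
    congr 1
    · exact Finset.sum_congr rfl fun j _ => by ring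
    · simp [Pi.single_apply, apply_ite]

end MvPolynomial

/-- The Jacobian determinant of the pair `(P, Q)`. -/
noncomputable def jacobian {R : Type*} [CommRing R] (P Q : MvPolynomial (Fin 2) R) :
    MvPolynomial (Fin 2) R :=
  pderiv 0 P * pderiv 1 Q - pderiv 1 P * pderiv 0 Q

theorem jacobian_bind₁ {R : Type*} [CommRing R] (P Q A B : MvPolynomial (Fin 2) R) :
    jacobian (bind₁ ![P, Q] A) (bind₁ ![P, Q] B) =
      bind₁ ![P, Q] (jacobian A B) * jacobian P Q := by
  simp only [jacobian, pderiv_bind₁, Fin.sum_univ_two, map_sub, map_mul, Matrix.cons_val_zero,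
    Matrix.cons_val_one]
  ring

theorem IsPolyAut.isUnit_jacobian {P Q : MvPolynomial (Fin 2) ℂ} (h : IsPolyAut P Q) :
    IsUnit (jacobian P Q) := by
  obtain ⟨A, B, hAB, -⟩ := h
  have key (v : Fin 2 → ℂ) (p : MvPolynomial (Fin 2) ℂ) :
      eval v (bind₁ ![P, Q] p) = eval ![eval v P, eval v Q] p := by
    rw [← coe_aeval_eq_eval, RingHom.coe_coe, aeval_bind₁, ← coe_aeval_eq_eval, RingHom.coe_coe]
    congr 2
    funext j
    fin_cases j <;> simp
  have hA : bind₁ ![P, Q] A = X 0 := MvPolynomial.funext fun v => by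
    rw [key, (hAB v).1, eval_X]
  have hB : bind₁ ![P, Q] B = X 1 := MvPolynomial.funext fun v => by
    rw [key, (hAB v).2, eval_X]
  have hJ := jacobian_bind₁ P Q A B
  rw [hA, hB] at hJ
  refine IsUnit.of_mul_eq_one_right _ (hJ.symm.trans ?_)
  simp [jacobian, pderiv_X]

theorem homogeneousComponent_jacobian {R : Type*} [CommRing R] {P Q : MvPolynomial (Fin 2) R}
    {m n : ℕ} (hP : P.totalDegree ≤ m + 1) (hQ : Q.totalDegree ≤ n + 1) :
    homogeneousComponent (m + n) (jacobian P Q) =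
      jacobian (homogeneousComponent (m + 1) P) (homogeneousComponent (n + 1) Q) := by
  simp only [jacobian, map_sub, ← homogeneousComponent_pderiv,
    homogeneousComponent_add_mul_of_totalDegree_le (totalDegree_pderiv_le hP)
      (totalDegree_pderiv_le hQ)]

/-- If `F = (P, Q)` is a polynomial automorphism of ℂ² with `deg P + deg Q > 2`,
then the Jacobian determinant of the leading homogeneous forms `P⁺`, `Q⁺`
(the homogeneous components of `P`, `Q` of degrees `deg P`, `deg Q`) vanishes
identically. -/
theorem jacobian_of_leading_forms_vanishes (P Q : MvPolynomial (Fin 2) ℂ)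
    (h : IsPolyAut P Q) (hdeg : P.totalDegree + Q.totalDegree > 2) :
    pderiv 0 (homogeneousComponent P.totalDegree P) *
        pderiv 1 (homogeneousComponent Q.totalDegree Q) -
      pderiv 1 (homogeneousComponent P.totalDegree P) *
        pderiv 0 (homogeneousComponent Q.totalDegree Q) = 0 := by
  change jacobian _ _ = 0
  rcases hp : P.totalDegree with _ | m
  · simp [jacobian]
  rcases hq : Q.totalDegree with _ | n
  · simp [jacobian]
  rw [← homogeneousComponent_jacobian hp.le hq.le]
  obtain ⟨-, hJ⟩ := isUnit_iff_totalDegree_of_isReduced.mp h.isUnit_jacobian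
  exact homogeneousComponent_eq_zero _ _ (by lia)
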